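/- There exists a ⟨28,28,28;10550⟩-algorithm over ℚ. -/

import Mathlib

open Matrix

/-- Row-major vectorization: `vec A (n*i+j) = A i j`. -/
def vec {F : Type*} {m n : ℕ} (A : Matrix (Fin m) (Fin n) F) : Fin (m * n) → F :=
  fun r => A r.divNat r.modNat

/-- `⟨U, V, W⟩` is an `⟨m, n, p; t⟩`-algorithm over `F`: for all `A, B, C` of the appropriate
sizes, `trace (A * B * C) = ∑ r, (U ⬝ᵥ vec A) r * (V ⬝ᵥ vec B) r * (W ⬝ᵥ vec C) r`. -/
def IsMMAlg {F : Type*} [Field F] (m n p t : ℕ)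
    (U : Matrix (Fin t) (Fin (m * n)) F)
    (V : Matrix (Fin t) (Fin (n * p)) F)
    (W : Matrix (Fin t) (Fin (p * m)) F) : Prop :=
  ∀ (A : Matrix (Fin m) (Fin n) F) (B : Matrix (Fin n) (Fin p) F) (C : Matrix (Fin p) (Fin m) F),
    (A * B * C).trace =
      ∑ r : Fin t, U.mulVec (vec A) r * V.mulVec (vec B) r * W.mulVec (vec C) r

/-- `f` is a trilinear form written as a sum of `t` products of linear forms. -/
def HasRank {X : Type} [AddCommGroup X] [Module ℚ X] (t : ℕ) (f : X → X → X → ℚ) : Prop :=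
  ∃ u v w : Fin t → X → ℚ,
    (∀ r, IsLinearMap ℚ (u r)) ∧ (∀ r, IsLinearMap ℚ (v r)) ∧ (∀ r, IsLinearMap ℚ (w r)) ∧
    ∀ A B C, f A B C = ∑ r, u r A * v r B * w r C

namespace HasRank

variable {X : Type} [AddCommGroup X] [Module ℚ X]

theorem zero : HasRank 0 (fun _ _ _ : X => (0 : ℚ)) :=
  ⟨fun _ _ => 0, fun _ _ => 0, fun _ _ => 0, fun r => r.elim0, fun r => r.elim0,
    fun r => r.elim0, fun _ _ _ => by simp⟩

theorem one {u v w : X → ℚ} (hu : IsLinearMap ℚ u) (hv : IsLinearMap ℚ v)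
    (hw : IsLinearMap ℚ w) : HasRank 1 (fun A B C => u A * v B * w C) :=
  ⟨fun _ => u, fun _ => v, fun _ => w, fun _ => hu, fun _ => hv, fun _ => hw,
    fun _ _ _ => by simp⟩

theorem add {s t : ℕ} {f g : X → X → X → ℚ} (hf : HasRank s f) (hg : HasRank t g) :
    HasRank (s + t) (fun A B C => f A B C + g A B C) := by
  obtain ⟨u, v, w, hu, hv, hw, h⟩ := hf
  obtain ⟨u', v', w', hu', hv', hw', h'⟩ := hg
  refine ⟨Fin.append u u', Fin.append v v', Fin.append w w', ?_, ?_, ?_, ?_⟩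
  · intro r
    induction r using Fin.addCases <;> simp [hu, hu']
  · intro r
    induction r using Fin.addCases <;> simp [hv, hv']
  · intro r
    induction r using Fin.addCases <;> simp [hw, hw']
  · intro A B C
    simp [Fin.sum_univ_add, h, h']

theorem sum {ι : Type} {t : ℕ} (s : Finset ι) (f : ι → X → X → X → ℚ)
    (h : ∀ i ∈ s, HasRank t (f i)) :
    HasRank (s.card * t) (fun A B C => ∑ i ∈ s, f i A B C) := by
  classical
  induction s using Finset.induction_on with
  | empty => simpa using (zero (X := X))
  | insert a s ha ih =>
    have h1 := (h a (Finset.mem_insert_self a s)).add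
      (ih (fun i hi => h i (Finset.mem_insert_of_mem hi)))
    have e : (insert a s).card * t = t + s.card * t := by
      rw [Finset.card_insert_of_notMem ha]; ring
    rw [e]
    simpa [Finset.sum_insert ha] using h1

theorem of_eq {s t : ℕ} {f g : X → X → X → ℚ} (hf : HasRank s f) (hst : s = t)
    (h : ∀ A B C, g A B C = f A B C) : HasRank t g := by
  subst hst
  obtain ⟨u, v, w, hu, hv, hw, h'⟩ := hf
  exact ⟨u, v, w, hu, hv, hw, fun A B C => by rw [h, h']⟩

theorem comp {Y : Type} [AddCommGroup Y] [Module ℚ Y] {t : ℕ} {f : X → X → X → ℚ}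
    (hf : HasRank t f) (L : Y → X) (hL : IsLinearMap ℚ L) :
    HasRank t (fun A B C => f (L A) (L B) (L C)) := by
  obtain ⟨u, v, w, hu, hv, hw, h⟩ := hf
  refine ⟨fun r A => u r (L A), fun r A => v r (L A), fun r A => w r (L A), ?_, ?_, ?_, ?_⟩
  · exact fun r => ⟨fun x y => by simp only [hL.map_add, (hu r).map_add],
      fun c x => by simp only [hL.map_smul, (hu r).map_smul]⟩
  · exact fun r => ⟨fun x y => by simp only [hL.map_add, (hv r).map_add],
      fun c x => by simp only [hL.map_smul, (hv r).map_smul]⟩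
  · exact fun r => ⟨fun x y => by simp only [hL.map_add, (hw r).map_add],
      fun c x => by simp only [hL.map_smul, (hw r).map_smul]⟩
  · exact fun A B C => h _ _ _

end HasRank

/-- Two by two block matrices with blocks of size `m`. -/
abbrev Blk (m : ℕ) := Fin 2 → Fin 2 → Fin m → Fin m → ℚ

/-- The sign attached to a parity. -/
def sg (x : Fin 2) : ℚ := if x = 0 then 1 else -1

@[simp] theorem sg_zero : sg 0 = 1 := rfl
@[simp] theorem sg_one : sg 1 = -1 := rfl

section

variable {m : ℕ}

/-- The aggregated product. -/
def agg (A B C : Blk m) (α β γ : Fin 2) (i j k : Fin m) : ℚ :=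
  (sg γ * A α β i j + sg β * A γ α j k + sg α * A β γ k i) *
  (B β γ j k + B α β k i + B γ α i j) *
  (sg γ * C γ α k i + sg β * C β γ i j + sg α * C α β j k)

/-- Sum of the eight aggregated products. -/
def aggSum (A B C : Blk m) (i j k : Fin m) : ℚ :=
  ∑ p : Fin 2 × Fin 2 × Fin 2, agg A B C p.1 p.2.1 p.2.2 i j k

/-- The desired terms. -/
def des (A B C : Blk m) (i j k : Fin m) : ℚ :=
  ∑ α, ∑ β, ∑ γ, A α β i j * B β γ j k * C γ α k i

/-- The correction terms. -/
def cor (A B C : Blk m) (i j : Fin m) : ℚ :=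
  ∑ α, ∑ β, ∑ γ, sg β * sg γ * (A α β i j * B γ α i j * C β γ i j)

/-- The terms which cancel when the third index is summed. -/
def rst (A B C : Blk m) (i j k : Fin m) : ℚ :=
  ∑ α, ∑ β, ∑ γ,
    (sg γ * A α β i j * B γ α i j * (sg γ * C γ α k i + sg α * C α β j k)
    + sg γ * A α β i j * (sg β * C β γ i j) * (B β γ j k + B α β k i)
    + B γ α i j * (sg β * C β γ i j) * (sg β * A γ α j k + sg α * A β γ k i))

theorem aggSum_cyc (A B C : Blk m) (i j k : Fin m) : aggSum A B C i j k = aggSum A B C j k i := by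
  simp only [aggSum, agg, Fintype.sum_prod_type, Fin.sum_univ_two, sg_zero, sg_one]
  ring

theorem aggSum_eq (A B C : Blk m) (i j k : Fin m) :
    aggSum A B C i j k = (des A B C i j k + des A B C j k i + des A B C k i j)
      + (cor A B C i j + cor A B C j k + cor A B C k i)
      + (rst A B C i j k + rst A B C j k i + rst A B C k i j) := by
  simp only [aggSum, agg, des, cor, rst, Fintype.sum_prod_type, Fin.sum_univ_two, sg_zero, sg_one]
  ring

theorem sum_rot (f : Fin m → Fin m → Fin m → ℚ) :
    ∑ i, ∑ j, ∑ k, f j k i = ∑ i, ∑ j, ∑ k, f i j k := by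
  rw [Finset.sum_comm]
  exact Finset.sum_congr rfl fun j _ => Finset.sum_comm

theorem sum_rot' (f : Fin m → Fin m → Fin m → ℚ) :
    ∑ i, ∑ j, ∑ k, f k i j = ∑ i, ∑ j, ∑ k, f i j k := by
  rw [← sum_rot (fun i j k => f k i j)]

/-- All row and column sums of all blocks vanish. -/
def ZeroSum (A : Blk m) : Prop :=
  (∀ α β i, ∑ j, A α β i j = 0) ∧ (∀ α β j, ∑ i, A α β i j = 0)

theorem sum_rst (A B C : Blk m) (hA : ZeroSum A) (hB : ZeroSum B) (hC : ZeroSum C)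
    (i j : Fin m) : ∑ k, rst A B C i j k = 0 := by
  unfold rst
  rw [Finset.sum_comm]
  refine Finset.sum_eq_zero fun α _ => ?_
  rw [Finset.sum_comm]
  refine Finset.sum_eq_zero fun β _ => ?_
  rw [Finset.sum_comm]
  refine Finset.sum_eq_zero fun γ _ => ?_
  simp only [Finset.sum_add_distrib, ← Finset.mul_sum, hA.1, hA.2, hB.1, hB.2, hC.1, hC.2]
  simp

theorem sum_aggSum (A B C : Blk m) (hA : ZeroSum A) (hB : ZeroSum B) (hC : ZeroSum C) :
    ∑ i, ∑ j, ∑ k, aggSum A B C i j k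
      = 3 * ∑ i, ∑ j, ∑ k, des A B C i j k + 3 * (m * ∑ i, ∑ j, cor A B C i j) := by
  simp only [aggSum_eq, Finset.sum_add_distrib]
  rw [sum_rot (des A B C), sum_rot' (des A B C), sum_rot (rst A B C), sum_rot' (rst A B C),
    sum_rot (fun i j _ => cor A B C i j), sum_rot' (fun i j _ => cor A B C i j)]
  simp only [sum_rst A B C hA hB hC]
  simp [← Finset.mul_sum]
  ring

/-- Representatives of the nonconstant triples up to rotation. -/
def reps (m : ℕ) : Finset (Fin m × Fin m × Fin m) :=
  Finset.univ.filter fun p => p.1 < p.2.1 ∧ p.1 ≤ p.2.2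

theorem sum_reps (f : Fin m → Fin m → Fin m → ℚ) (hf : ∀ i j k, f i j k = f j k i) :
    ∑ i, ∑ j, ∑ k, f i j k = 3 * ∑ p ∈ reps m, f p.1 p.2.1 p.2.2 + ∑ i, f i i i := by
  have h0 : ∑ p ∈ reps m, f p.1 p.2.1 p.2.2
      = ∑ i, ∑ j, ∑ k, (if i < j ∧ i ≤ k then f i j k else 0) := by
    rw [reps, Finset.sum_filter, Fintype.sum_prod_type]
    simp only [Fintype.sum_prod_type]
  have h1 : ∑ i, f i i i = ∑ i, ∑ j, ∑ k, (if i = j ∧ i = k then f i j k else 0) := by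
    refine Finset.sum_congr rfl fun i _ => ?_
    simp only [ite_and, Finset.sum_ite_irrel, Finset.sum_ite_eq, Finset.mem_univ, if_true,
      Finset.sum_const_zero]
  have hp : ∀ i j k, f i j k = (if i < j ∧ i ≤ k then f i j k else 0)
      + (if j < k ∧ j ≤ i then f j k i else 0) + (if k < i ∧ k ≤ j then f k i j else 0)
      + (if i = j ∧ i = k then f i j k else 0) := by
    intro i j k
    rw [hf k i j, ← hf i j k]
    by_cases a1 : i < j ∧ i ≤ k
    · have a2 : ¬ (j < k ∧ j ≤ i) := by omega
      have a3 : ¬ (k < i ∧ k ≤ j) := by omega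
      have a4 : ¬ (i = j ∧ i = k) := by omega
      simp only [a1, a2, a3, a4]; simp
    by_cases a2 : j < k ∧ j ≤ i
    · have a3 : ¬ (k < i ∧ k ≤ j) := by omega
      have a4 : ¬ (i = j ∧ i = k) := by omega
      simp only [a1, a2, a3, a4]; simp
    by_cases a3 : k < i ∧ k ≤ j
    · have a4 : ¬ (i = j ∧ i = k) := by omega
      simp only [a1, a2, a3, a4]; simp
    have a4 : (i = j ∧ i = k) := by omega
    rw [if_neg a1, if_neg a2, if_neg a3, if_pos a4]; simp
  have hs : ∑ i, ∑ j, ∑ k, f i j k = ∑ i, ∑ j, ∑ k, ((if i < j ∧ i ≤ k then f i j k else 0)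
      + (if j < k ∧ j ≤ i then f j k i else 0) + (if k < i ∧ k ≤ j then f k i j else 0)
      + (if i = j ∧ i = k then f i j k else 0)) :=
    Finset.sum_congr rfl fun i _ => Finset.sum_congr rfl fun j _ =>
      Finset.sum_congr rfl fun k _ => hp i j k
  rw [hs, h0, h1]
  simp only [Finset.sum_add_distrib]
  rw [sum_rot (fun i j k => if i < j ∧ i ≤ k then f i j k else 0),
    sum_rot' (fun i j k => if i < j ∧ i ≤ k then f i j k else 0)]
  ring

theorem sum_des (A B C : Blk m) (hA : ZeroSum A) (hB : ZeroSum B) (hC : ZeroSum C) :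
    ∑ i, ∑ j, ∑ k, des A B C i j k
      = ∑ p ∈ reps m, aggSum A B C p.1 p.2.1 p.2.2
        + ∑ p ∈ Finset.univ.offDiag, (-(m : ℚ)) * cor A B C p.1 p.2
        + ∑ i, (aggSum A B C i i i / 3 - m * cor A B C i i) := by
  have h1 := sum_aggSum A B C hA hB hC
  rw [sum_reps _ (aggSum_cyc A B C)] at h1
  have h2 : ∑ i, ∑ j, cor A B C i j
      = ∑ p ∈ Finset.univ.offDiag, cor A B C p.1 p.2 + ∑ i, cor A B C i i := by
    rw [← Finset.sum_product', ← Finset.diag_union_offDiag,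
      Finset.sum_union (Finset.disjoint_diag_offDiag _), Finset.sum_diag, add_comm]
  rw [h2] at h1
  rw [Finset.sum_sub_distrib, ← Finset.sum_div, ← Finset.mul_sum, ← Finset.mul_sum]
  linarith

end

theorem rank_aggSum (m : ℕ) (i j k : Fin m) :
    HasRank 8 (fun A B C : Blk m => aggSum A B C i j k) := by
  refine (HasRank.sum (t := 1) (Finset.univ : Finset (Fin 2 × Fin 2 × Fin 2))
    (fun p A B C => agg A B C p.1 p.2.1 p.2.2 i j k) ?_).of_eq (by rfl) (fun _ _ _ => rfl)
  rintro ⟨α, β, γ⟩ -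
  unfold agg
  refine HasRank.one
    (u := fun A : Blk m => sg γ * A α β i j + sg β * A γ α j k + sg α * A β γ k i)
    (v := fun B : Blk m => B β γ j k + B α β k i + B γ α i j)
    (w := fun C : Blk m => sg γ * C γ α k i + sg β * C β γ i j + sg α * C α β j k) ?_ ?_ ?_
  all_goals constructor <;> intros <;> simp <;> ring

/-- A linear form in the four entries at one position. -/
def lf {m : ℕ} (i j : Fin m) (a b c d : ℚ) (A : Blk m) : ℚ :=
  a * A 0 0 i j + b * A 0 1 i j + c * A 1 0 i j + d * A 1 1 i j

theorem lf_lin {m : ℕ} (i j : Fin m) (a b c d : ℚ) : IsLinearMap ℚ (lf i j a b c d) := by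
  constructor <;> intros <;> simp [lf] <;> ring

theorem rank_cor (i j : Fin 15) :
    HasRank 7 (fun A B C : Blk 15 => (-((15 : ℕ) : ℚ)) * cor A B C i j) := by
  refine HasRank.of_eq (
    ((((((HasRank.one (lf_lin i j (-15) 0 0 (-15)) (lf_lin i j 1 0 0 1)
    (lf_lin i j 1 0 0 1)).add
    (HasRank.one (lf_lin i j 0 0 (-15) (-15)) (lf_lin i j 0 1 0 (-1))
    (lf_lin i j 1 0 0 0))).add
    (HasRank.one (lf_lin i j (-15) 0 0 0) (lf_lin i j 0 0 1 1)
    (lf_lin i j 0 (-1) 0 (-1)))).add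
    (HasRank.one (lf_lin i j 0 0 0 (-15)) (lf_lin i j 1 1 0 0)
    (lf_lin i j (-1) 0 (-1) 0))).add
    (HasRank.one (lf_lin i j (-15) (-15) 0 0) (lf_lin i j (-1) 0 1 0)
    (lf_lin i j 0 0 0 1))).add
    (HasRank.one (lf_lin i j 15 0 (-15) 0) (lf_lin i j 0 0 0 1)
    (lf_lin i j 1 (-1) 0 0))).add
    (HasRank.one (lf_lin i j 0 (-15) 0 15) (lf_lin i j 1 0 0 0)
    (lf_lin i j 0 0 (-1) 1))) (by norm_num) ?_
  intro A B C
  simp only [cor, lf, Fin.sum_univ_two, sg_zero, sg_one]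
  push_cast
  ring

theorem rank_diag (i : Fin 15) :
    HasRank 8 (fun A B C : Blk 15 => aggSum A B C i i i / 3 - ((15 : ℕ) : ℚ) * cor A B C i i) := by
  refine HasRank.of_eq (
    (((((((HasRank.one (lf_lin i i (85/24) (205/24) (55/24) (-5/24))
    (lf_lin i i (17/15) (-41/15) (-11/15) (-1/15))
    (lf_lin i i (17/15) (-41/15) (11/15) (1/15))).add
    (HasRank.one (lf_lin i i (-5/12) (-65/12) (5/6) (10/3))
    (lf_lin i i (2/15) (-26/15) (4/15) (-16/15))
    (lf_lin i i (2/15) (-26/15) (-4/15) (16/15)))).add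
    (HasRank.one (lf_lin i i (-5) (-25/4) 0 (-5/4))
    (lf_lin i i (8/5) (-2) 0 (2/5))
    (lf_lin i i (8/5) (-2) 0 (-2/5)))).add
    (HasRank.one (lf_lin i i (-15/8) (25/8) (-25/8) (15/8))
    (lf_lin i i (3/5) 1 (-1) (-3/5))
    (lf_lin i i (3/5) 1 1 (3/5)))).add
    (HasRank.one (lf_lin i i (-2/5) 0 0 (2/5))
    (lf_lin i i 1 0 0 (-1))
    (lf_lin i i 1 0 0 1))).add
    (HasRank.one (lf_lin i i (-5/3) (-35/3) (5/6) (-5/3))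
    (lf_lin i i (-7/15) (-11/15) (-11/15) (-7/15))
    (lf_lin i i 1 (-1) 1 (-1)))).add
    (HasRank.one (lf_lin i i (-25/8) (-25/8) (-25/8) (-25/8))
    (lf_lin i i (8/15) (-56/15) (4/15) (8/15))
    (lf_lin i i (-7/15) (-11/15) (11/15) (7/15)))).add
    (HasRank.one (lf_lin i i (35/24) (-55/24) (-55/24) (35/24))
    (lf_lin i i 1 (-1) (-1) 1)
    (lf_lin i i (8/15) (-56/15) (-4/15) (-8/15)))) (by norm_num) ?_
  intro A B C
  simp only [cor, aggSum, agg, lf, Fintype.sum_prod_type, Fin.sum_univ_two, sg_zero, sg_one]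
  push_cast
  ring

theorem card_reps : (reps 15).card = 1120 := by
  have h := sum_reps (m := 15) (fun _ _ _ => 1) (fun _ _ _ => rfl)
  simp only [Finset.sum_const, Finset.card_univ, Fintype.card_fin, nsmul_eq_mul, mul_one] at h
  have h' : ((reps 15).card : ℚ) = 1120 := by
    push_cast at h
    linarith
  exact_mod_cast h'

/-- The main decomposition on zero-sum block matrices. -/
theorem rank_main : HasRank 10550 (fun A B C : Blk 15 =>
    ∑ p ∈ reps 15, aggSum A B C p.1 p.2.1 p.2.2
        + ∑ p ∈ Finset.univ.offDiag, (-((15 : ℕ) : ℚ)) * cor A B C p.1 p.2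
        + ∑ i, (aggSum A B C i i i / 3 - ((15 : ℕ) : ℚ) * cor A B C i i)) := by
  refine HasRank.of_eq (((HasRank.sum (t := 8) (reps 15)
      (fun p A B C => aggSum A B C p.1 p.2.1 p.2.2) fun p _ => rank_aggSum 15 _ _ _).add
    (HasRank.sum (t := 7) (Finset.univ : Finset (Fin 15)).offDiag
      (fun p A B C => (-((15 : ℕ) : ℚ)) * cor A B C p.1 p.2) fun p _ => rank_cor _ _)).add
    (HasRank.sum (t := 8) (Finset.univ : Finset (Fin 15))
      (fun i A B C => aggSum A B C i i i / 3 - ((15 : ℕ) : ℚ) * cor A B C i i)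
      fun i _ => rank_diag i)) ?_ (fun _ _ _ => rfl)
  rw [card_reps, Finset.offDiag_card]
  simp

/-- Left extension matrix. -/
def extL : Matrix (Fin 15) (Fin 14) ℚ :=
  fun i p => (if i = p.castSucc then 1 else 0) - 1 / 15

/-- Right extension matrix. -/
def extR : Matrix (Fin 14) (Fin 15) ℚ :=
  fun q j => (if j = q.castSucc then 1 else 0) - (if j = Fin.last 14 then 1 else 0)

theorem extL_sum (p : Fin 14) : ∑ i, extL i p = 0 := by
  simp [extL, Finset.sum_sub_distrib]

theorem extR_sum (q : Fin 14) : ∑ j, extR q j = 0 := by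
  simp [extR, Finset.sum_sub_distrib]

theorem extR_mul_extL : extR * extL = 1 := by
  ext q p
  have h : ∀ j, extR q j * extL j p = (if j = q.castSucc then extL j p else 0)
      - (if j = Fin.last 14 then extL j p else 0) := by
    intro j
    simp only [extR, sub_mul, ite_mul, one_mul, zero_mul]
  rw [Matrix.mul_apply, Finset.sum_congr rfl fun j _ => h j, Finset.sum_sub_distrib]
  have h5 : ¬ (Fin.last 14 = p.castSucc) := (Fin.castSucc_lt_last p).ne'
  simp only [Finset.sum_ite_eq', Finset.mem_univ, if_true, extL, h5, if_false, Matrix.one_apply,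
    Fin.castSucc_inj]
  ring

/-- The blocks of a matrix of size 28. -/
def blk (A : Matrix (Fin 28) (Fin 28) ℚ) (α β : Fin 2) : Matrix (Fin 14) (Fin 14) ℚ :=
  fun p q => A (finProdFinEquiv (m := 2) (n := 14) (α, p)) (finProdFinEquiv (m := 2) (n := 14) (β, q))

/-- The zero-sum extension. -/
def ext0 (A : Matrix (Fin 28) (Fin 28) ℚ) : Blk 15 :=
  fun α β => extL * blk A α β * extR

theorem ext0_lin : IsLinearMap ℚ ext0 := by
  constructor
  · intro A B
    funext α β
    have : blk (A + B) α β = blk A α β + blk B α β := rfl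
    simp only [ext0, this, Matrix.mul_add, Matrix.add_mul]
    rfl
  · intro c A
    funext α β
    have : blk (c • A) α β = c • blk A α β := rfl
    simp only [ext0, this, Matrix.mul_smul, Matrix.smul_mul]
    rfl

theorem ext0_zeroSum (A : Matrix (Fin 28) (Fin 28) ℚ) : ZeroSum (ext0 A) := by
  constructor
  · intro α β i
    simp only [ext0, Matrix.mul_apply]
    rw [Finset.sum_comm]
    simp only [← Finset.mul_sum, extR_sum, mul_zero, Finset.sum_const_zero]
  · intro α β j
    have h : ∀ i, ext0 A α β i j = ∑ p, extL i p * (blk A α β * extR) p j := by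
      intro i
      rw [← Matrix.mul_apply, ← Matrix.mul_assoc]
      rfl
    rw [Finset.sum_congr rfl fun i _ => h i, Finset.sum_comm]
    simp only [← Finset.sum_mul, extL_sum, zero_mul, Finset.sum_const_zero]

theorem trace_three {n : ℕ} (A B C : Matrix (Fin n) (Fin n) ℚ) :
    (A * B * C).trace = ∑ i, ∑ j, ∑ k, A i j * B j k * C k i := by
  simp only [Matrix.trace, Matrix.diag_apply, Matrix.mul_apply, Finset.sum_mul]
  exact Finset.sum_congr rfl fun i _ => Finset.sum_comm

theorem trace_ext (a b c : Matrix (Fin 14) (Fin 14) ℚ) :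
    ((extL * a * extR) * (extL * b * extR) * (extL * c * extR)).trace = (a * b * c).trace := by
  have h : (extL * a * extR) * (extL * b * extR) * (extL * c * extR)
      = extL * (a * ((extR * extL) * (b * ((extR * extL) * (c * extR))))) := by
    simp only [Matrix.mul_assoc]
  rw [h, extR_mul_extL, Matrix.trace_mul_comm]
  simp only [Matrix.mul_assoc, Matrix.one_mul, extR_mul_extL, Matrix.mul_one]

theorem sum28 (f : Fin 28 → ℚ) :
    ∑ i, f i = ∑ α : Fin 2, ∑ p : Fin 14, f (finProdFinEquiv (m := 2) (n := 14) (α, p)) := by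
  rw [← Fintype.sum_prod_type']
  exact (Equiv.sum_comp (finProdFinEquiv (m := 2) (n := 14)) f).symm

theorem sum_swap_six (f : Fin 2 → Fin 2 → Fin 2 → Fin 14 → Fin 14 → Fin 14 → ℚ) :
    ∑ α, ∑ p, ∑ β, ∑ q, ∑ γ, ∑ r, f α β γ p q r
      = ∑ α, ∑ β, ∑ γ, ∑ p, ∑ q, ∑ r, f α β γ p q r := by
  simp only [Fin.sum_univ_two, Finset.sum_add_distrib]

theorem sum_des_swap (A B C : Blk 15) :
    ∑ i, ∑ j, ∑ k, des A B C i j k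
      = ∑ α, ∑ β, ∑ γ, ∑ i, ∑ j, ∑ k, A α β i j * B β γ j k * C γ α k i := by
  simp only [des, Fin.sum_univ_two, Finset.sum_add_distrib]

theorem trace_eq (A B C : Matrix (Fin 28) (Fin 28) ℚ) :
    (A * B * C).trace = ∑ i, ∑ j, ∑ k, des (ext0 A) (ext0 B) (ext0 C) i j k := by
  rw [sum_des_swap, trace_three]
  simp only [sum28]
  refine (sum_swap_six fun α β γ p q r =>
    blk A α β p q * blk B β γ q r * blk C γ α r p).trans ?_
  refine Finset.sum_congr rfl fun α _ => Finset.sum_congr rfl fun β _ =>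
    Finset.sum_congr rfl fun γ _ => ?_
  rw [← trace_three, ← trace_ext, trace_three]
  rfl

theorem rank_trace : HasRank 10550
    (fun A B C : Matrix (Fin 28) (Fin 28) ℚ => (A * B * C).trace) :=
  (rank_main.comp ext0 ext0_lin).of_eq rfl fun A B C => by
    rw [trace_eq, sum_des _ _ _ (ext0_zeroSum A) (ext0_zeroSum B) (ext0_zeroSum C)]

/-- The matrix unit at a vectorized position. -/
def unitAt (x : Fin (28 * 28)) : Matrix (Fin 28) (Fin 28) ℚ :=
  fun i j => if finProdFinEquiv (i, j) = x then 1 else 0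

theorem sum_unitAt (A : Matrix (Fin 28) (Fin 28) ℚ) : A = ∑ x, _root_.vec A x • unitAt x := by
  ext i j
  rw [Matrix.sum_apply]
  have h : ∀ x, (_root_.vec A x • unitAt x) i j = if finProdFinEquiv (i, j) = x then _root_.vec A x else 0 := by
    intro x
    simp [unitAt]
  rw [Finset.sum_congr rfl fun x _ => h x]
  rw [Finset.sum_ite_eq, if_pos (Finset.mem_univ _)]
  have h2 := finProdFinEquiv.symm_apply_apply (i, j)
  have h3 : (finProdFinEquiv (i, j)).divNat = i := congrArg Prod.fst h2
  have h4 : (finProdFinEquiv (i, j)).modNat = j := congrArg Prod.snd h2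
  unfold _root_.vec
  rw [h3, h4]

theorem mulVec_functional {t : ℕ} (u : Fin t → Matrix (Fin 28) (Fin 28) ℚ → ℚ)
    (hu : ∀ r, IsLinearMap ℚ (u r)) (A : Matrix (Fin 28) (Fin 28) ℚ) (r : Fin t) :
    (Matrix.of fun r x => u r (unitAt x)).mulVec (_root_.vec A) r = u r A := by
  conv_rhs => rw [sum_unitAt A]
  have h := map_sum ((hu r).mk' (u r)) (fun x => _root_.vec A x • unitAt x) Finset.univ
  simp only [IsLinearMap.mk'_apply] at h
  rw [h]
  simp only [Matrix.mulVec, dotProduct, Matrix.of_apply]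
  refine Finset.sum_congr rfl fun x _ => ?_
  rw [(hu r).map_smul, smul_eq_mul, mul_comm]

/-- There exists a `⟨28,28,28;10550⟩`-algorithm over `ℚ`. -/
theorem exists_28_28_28_10550_algorithm :
    ∃ (U V W : Matrix (Fin 10550) (Fin (28 * 28)) ℚ),
      IsMMAlg 28 28 28 10550 U V W := by
  obtain ⟨u, v, w, hu, hv, hw, h⟩ := rank_trace
  refine ⟨Matrix.of fun r x => u r (unitAt x), Matrix.of fun r x => v r (unitAt x),
    Matrix.of fun r x => w r (unitAt x), ?_⟩
  intro A B C
  refine (h A B C).trans ?_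
  refine Finset.sum_congr rfl fun r _ => ?_
  rw [mulVec_functional u hu, mulVec_functional v hv, mulVec_functional w hw]
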